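/- Let n be a positive integer and let 𝒞 be the convex set of all positive semidefinite n × n complex matrices A with A_{ii} = 1 for all i. Let V be a finite dimensional complex inner product space, let η_1, …, η_n ∈ V be vectors whose linear span is all of V, and let A be the matrix A_{ij} = ⟨η_i, η_j⟩. Then A is an extreme point of 𝒞 if and only if the rank one operators |η_i⟩⟨η_i| (i.e. the maps ξ ↦ ⟨η_i, ξ⟩ η_i), i = 1, …, n, span the full space of linear endomorphisms of V. -/

import Mathlib

open scoped ComplexInnerProductSpace ComplexOrder

noncomputable section

open Matrix in
lemma gram_aux {n : ℕ} {V : Type*} [NormedAddCommGroup V] [InnerProductSpace ℂ V]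
    [FiniteDimensional ℂ V] (η : Fin n → V) (T : V →L[ℂ] V) (x y : Fin n → ℂ) :
    star x ⬝ᵥ ((Matrix.of fun i j => ⟪η i, T (η j)⟫) *ᵥ y) =
      ⟪∑ i, x i • η i, T (∑ j, y j • η j)⟫ := by
  simp only [map_sum, map_smul, sum_inner, inner_sum, inner_smul_left, inner_smul_right,
    dotProduct, mulVec, Matrix.of_apply, Pi.star_apply, Finset.mul_sum]
  rw [Finset.sum_comm]
  refine Finset.sum_congr rfl fun i _ => Finset.sum_congr rfl fun j _ => ?_
  simp only [RCLike.star_def]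
  ring

lemma gram_psd {n : ℕ} {V : Type*} [NormedAddCommGroup V] [InnerProductSpace ℂ V]
    [FiniteDimensional ℂ V] (η : Fin n → V) (T : V →L[ℂ] V) (hT : T.IsPositive) :
    (Matrix.of fun i j => ⟪η i, T (η j)⟫).PosSemidef := by
  refine Matrix.PosSemidef.of_dotProduct_mulVec_nonneg ?_ ?_
  · ext i j
    simp only [Matrix.conjTranspose_apply, Matrix.of_apply, RCLike.star_def, inner_conj_symm]
    exact hT.isSymmetric _ _
  · intro x
    rw [gram_aux]
    exact hT.inner_nonneg_right _

lemma isPos_aux {V : Type*} [NormedAddCommGroup V] [InnerProductSpace ℂ V]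
    [FiniteDimensional ℂ V] (T : V →L[ℂ] V) (hT : IsSelfAdjoint T) (hn : ‖T‖ ≤ 1) :
    (1 + T).IsPositive := by
  rw [ContinuousLinearMap.isPositive_def']
  refine ⟨(IsSelfAdjoint.one _).add hT, fun x => ?_⟩
  rw [ContinuousLinearMap.reApplyInnerSelf_apply]
  simp only [ContinuousLinearMap.add_apply, ContinuousLinearMap.one_apply, inner_add_left, map_add]
  have h1 : ‖⟪T x, x⟫‖ ≤ ‖x‖ * ‖x‖ :=
    (norm_inner_le_norm _ _).trans (mul_le_mul_of_nonneg_right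
      ((T.le_opNorm x).trans (mul_le_of_le_one_left (norm_nonneg _) hn)) (norm_nonneg _))
  have h2 := (abs_le.1 (RCLike.abs_re_le_norm (⟪T x, x⟫))).1
  have h3 : RCLike.re ⟪x, x⟫ = ‖x‖ * ‖x‖ := inner_self_eq_norm_mul_norm (𝕜 := ℂ) x
  linarith

lemma zero_of_gram {n : ℕ} {V : Type*} [NormedAddCommGroup V] [InnerProductSpace ℂ V]
    (η : Fin n → V) (hspan : Submodule.span ℂ (Set.range η) = ⊤) (T : V →L[ℂ] V)
    (h : ∀ i j, ⟪η i, T (η j)⟫ = 0) : T = 0 := by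
  have h1 : ∀ j, T (η j) = 0 := by
    intro j
    have : (innerSL ℂ (T (η j))).toLinearMap = 0 := by
      apply LinearMap.ext_on_range hspan
      intro i
      simpa using inner_eq_zero_symm.1 (h i j)
    exact (inner_self_eq_zero (𝕜 := ℂ)).1 (LinearMap.congr_fun this (T (η j)))
  have : T.toLinearMap = 0 := LinearMap.ext_on_range hspan (fun j => by simpa using h1 j)
  ext x
  simpa using LinearMap.congr_fun this x

lemma sa_zero {n : ℕ} {V : Type*} [NormedAddCommGroup V] [InnerProductSpace ℂ V]
    [FiniteDimensional ℂ V]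
    (η : Fin n → V) (hspan : Submodule.span ℂ (Set.range η) = ⊤)
    (A : Matrix (Fin n) (Fin n) ℂ) (hA : ∀ i j, A i j = ⟪η i, η j⟫)
    (hdiag : ∀ i, A i i = 1)
    (hext : ∀ A₁ A₂ : Matrix (Fin n) (Fin n) ℂ,
        A₁.PosSemidef → (∀ i, A₁ i i = 1) → A₂.PosSemidef → (∀ i, A₂ i i = 1) →
        ∀ t : ℝ, 0 < t → t < 1 →
          A = (t : ℂ) • A₁ + ((1 - t : ℝ) : ℂ) • A₂ → A₁ = A ∧ A₂ = A)
    (T : V →L[ℂ] V) (hT : IsSelfAdjoint T) (h0 : ∀ i, ⟪η i, T (η i)⟫ = 0) : T = 0 := by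
  by_contra hne
  have hpos : 0 < ‖T‖ := norm_pos_iff.2 hne
  set S : V →L[ℂ] V := ((‖T‖⁻¹ : ℝ) : ℂ) • T with hS
  have hSa : IsSelfAdjoint S := by
    refine IsSelfAdjoint.smul ?_ hT
    simp [isSelfAdjoint_iff]
  have hSn : ‖S‖ ≤ 1 := by
    rw [hS, norm_smul]
    simp [hpos.ne']
  have hS0 : ∀ i, ⟪η i, S (η i)⟫ = 0 := by
    intro i
    simp [hS, inner_smul_right, h0]
  have hd : ∀ i, ⟪η i, η i⟫ = 1 := fun i => by rw [← hA, hdiag]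
  obtain ⟨h1, -⟩ := hext _ _ (gram_psd η _ (isPos_aux S hSa hSn))
    (fun i => by simp only [Matrix.of_apply, ContinuousLinearMap.add_apply, ContinuousLinearMap.one_apply, inner_add_right, hd, hS0, add_zero])
    (gram_psd η _ (isPos_aux (-S) hSa.neg (by simpa using hSn)))
    (fun i => by simp only [Matrix.of_apply, ContinuousLinearMap.add_apply, ContinuousLinearMap.one_apply, ContinuousLinearMap.neg_apply, inner_neg_right, inner_add_right, hd, hS0, neg_zero, add_zero]) (1/2) (by norm_num) (by norm_num)
    (by
      ext i j
      simp only [hA, Matrix.add_apply, Matrix.smul_apply, smul_eq_mul, Matrix.of_apply, ContinuousLinearMap.add_apply, ContinuousLinearMap.one_apply, ContinuousLinearMap.neg_apply, inner_neg_right, inner_add_right]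
      push_cast
      ring)
  have hz : S = 0 := by
    apply zero_of_gram η hspan
    intro i j
    have := congrFun (congrFun h1 i) j
    simpa [hA, inner_add_right] using this
  rw [hS] at hz
  rcases smul_eq_zero.1 hz with h | h
  · simp [hpos.ne'] at h
  · exact hne h

lemma all_zero {n : ℕ} {V : Type*} [NormedAddCommGroup V] [InnerProductSpace ℂ V]
    [FiniteDimensional ℂ V] (η : Fin n → V)
    (hsa : ∀ T : V →L[ℂ] V, IsSelfAdjoint T → (∀ i, ⟪η i, T (η i)⟫ = 0) → T = 0)
    (T : V →L[ℂ] V) (h0 : ∀ i, ⟪η i, T (η i)⟫ = 0) : T = 0 := by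
  have h0' : ∀ i, ⟪η i, (star T) (η i)⟫ = 0 := by
    intro i
    rw [ContinuousLinearMap.star_eq_adjoint, ContinuousLinearMap.adjoint_inner_right]
    exact inner_eq_zero_symm.1 (h0 i)
  have h1 := hsa (T + star T) (by simp [isSelfAdjoint_iff, add_comm])
    (fun i => by simp only [ContinuousLinearMap.add_apply, inner_add_right, h0, h0', add_zero])
  have h2 := hsa (Complex.I • (T - star T)) (by
      rw [isSelfAdjoint_iff, star_smul, star_sub, star_star, ← neg_sub T, smul_neg]
      simp)
    (fun i => by
      simp only [ContinuousLinearMap.smul_apply, ContinuousLinearMap.sub_apply, inner_smul_right,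
        inner_sub_right, h0, h0', sub_zero, mul_zero])
  have h3 : T - star T = 0 := (smul_eq_zero.1 h2).resolve_left Complex.I_ne_zero
  have h4 : (2 : ℂ) • T = 0 := by
    rw [two_smul]
    calc T + T = (T + star T) + (T - star T) := by abel
      _ = 0 := by rw [h1, h3, add_zero]
  exact (smul_eq_zero.1 h4).resolve_left two_ne_zero

/-- the rank one operator `|ξ⟩⟨ζ|` -/
abbrev ketbra {V : Type*} [NormedAddCommGroup V] [InnerProductSpace ℂ V] (ξ ζ : V) : V →L[ℂ] V :=
  (innerSL ℂ ζ).smulRight ξ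

lemma span_of_ext {n : ℕ} {V : Type*} [NormedAddCommGroup V] [InnerProductSpace ℂ V]
    [FiniteDimensional ℂ V] (η : Fin n → V)
    (hz : ∀ T : V →L[ℂ] V, (∀ i, ⟪η i, T (η i)⟫ = 0) → T = 0) :
    Submodule.span ℂ (Set.range fun i : Fin n => ketbra (η i) (η i)) = ⊤ := by
  by_contra hne
  obtain ⟨f, hf, hle⟩ := Submodule.exists_le_ker_of_lt_top _ (lt_top_iff_ne_top.2 hne)
  let e := stdOrthonormalBasis ℂ V
  let T0 : V →ₗ[ℂ] V :=
    { toFun := fun ξ => ∑ k, f (ketbra ξ (e k)) • e k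
      map_add' := fun x y => by
        have : ∀ k, ketbra (x + y) (e k) = ketbra x (e k) + ketbra y (e k) := fun k => by
          ext z; simp
        simp only [this, map_add, add_smul, Finset.sum_add_distrib]
      map_smul' := fun c x => by
        have : ∀ k, ketbra (c • x) (e k) = c • ketbra x (e k) := fun k => by
          ext z; exact smul_comm _ _ _
        simp only [this, map_smul, smul_eq_mul, mul_smul, Finset.smul_sum, RingHom.id_apply] }
  have key : ∀ ξ ζ, ⟪ζ, T0 ξ⟫ = f (ketbra ξ ζ) := by
    intro ξ ζ
    have h1 : ketbra ξ ζ = ∑ k, ⟪ζ, e k⟫ • ketbra ξ (e k) := by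
      ext z
      simp only [ContinuousLinearMap.sum_apply, ContinuousLinearMap.smul_apply,
        ContinuousLinearMap.smulRight_apply, innerSL_apply_apply, smul_smul, ← Finset.sum_smul,
        e.sum_inner_mul_inner]
    rw [h1, map_sum]
    simp only [T0, LinearMap.coe_mk, AddHom.coe_mk, inner_sum, inner_smul_right, map_smul,
      smul_eq_mul]
    exact Finset.sum_congr rfl fun k _ => mul_comm _ _
  have hT := hz (LinearMap.toContinuousLinearMap T0) (fun i => by
    simp only [LinearMap.coe_toContinuousLinearMap', key]
    exact hle (Submodule.subset_span ⟨i, rfl⟩))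
  have hT0 : ∀ x, T0 x = 0 := fun x => by
    simpa using congrArg (fun S : V →L[ℂ] V => S x) hT
  apply hf
  ext R
  have hR : R = ∑ k, ketbra (R (e k)) (e k) := by
    ext z
    simp only [ContinuousLinearMap.sum_apply, ContinuousLinearMap.smulRight_apply,
      innerSL_apply_apply]
    conv_lhs => rw [← e.sum_repr' z]
    simp
  rw [hR, map_sum]
  simp [← key, hT0]

open Matrix in
lemma ext_of_span {n : ℕ} {V : Type*} [NormedAddCommGroup V] [InnerProductSpace ℂ V]
    [FiniteDimensional ℂ V]
    (η : Fin n → V) (hspan : Submodule.span ℂ (Set.range η) = ⊤)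
    (hs : Submodule.span ℂ (Set.range fun i : Fin n => ketbra (η i) (η i)) = ⊤)
    (B : Matrix (Fin n) (Fin n) ℂ) (hB : B.IsHermitian) (hd : ∀ i, B i i = 0)
    (hker : ∀ x : Fin n → ℂ, ∑ i, x i • η i = 0 → B *ᵥ x = 0) : B = 0 := by
  let M : (Fin n → ℂ) →ₗ[ℂ] V := Fintype.linearCombination ℂ η
  have hM : LinearMap.range M = ⊤ := by
    rw [← hspan]; exact Fintype.range_linearCombination ℂ η
  obtain ⟨N, hN⟩ := LinearMap.exists_rightInverse_of_surjective M hM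
  have hk : ∀ j, B *ᵥ (N (η j)) = B *ᵥ Pi.single j 1 := by
    intro j
    rw [← sub_eq_zero, ← mulVec_sub]
    apply hker
    have : M (N (η j) - Pi.single j 1) = 0 := by
      rw [map_sub, sub_eq_zero]
      have := LinearMap.congr_fun hN (η j)
      simp only [LinearMap.comp_apply, LinearMap.id_apply] at this
      rw [this]
      simp [M, Fintype.linearCombination_apply_single]
    simpa [M, Fintype.linearCombination_apply] using this
  have hb : ∀ i j, star (N (η i)) ⬝ᵥ (B *ᵥ N (η j)) = B i j := by
    intro i j
    rw [hk, dotProduct_mulVec]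
    have : star (N (η i)) ᵥ* B = star (B *ᵥ N (η i)) := by
      rw [star_mulVec, hB.eq]
    rw [this, hk, star_mulVec, hB.eq, ← dotProduct_mulVec]
    simp
  let e := stdOrthonormalBasis ℂ V
  let φ : (V →L[ℂ] V) →ₗ[ℂ] ℂ :=
    { toFun := fun R => ∑ k, star (N (e k)) ⬝ᵥ (B *ᵥ N (R (e k)))
      map_add' := fun x y => by
        simp [mulVec_add, dotProduct_add, Finset.sum_add_distrib]
      map_smul' := fun c x => by
        simp [mulVec_smul, dotProduct_smul, Finset.mul_sum] }
  have hφ : ∀ ξ ζ, φ (ketbra ξ ζ) = star (N ζ) ⬝ᵥ (B *ᵥ N ξ) := by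
    intro ξ ζ
    conv_rhs => rw [← e.sum_repr' ζ]
    simp [φ, star_sum, sum_dotProduct, mulVec_smul, dotProduct_smul, smul_dotProduct]
  have h0 : φ = 0 := by
    apply LinearMap.ext_on_range hs
    intro i
    rw [hφ, hb, hd]; rfl
  ext i j
  rw [← hb, ← hφ, h0]; rfl

/-- A Gram matrix `A_{ij} = ⟨η_i, η_j⟩` of spanning vectors with unit
diagonal is an extreme point of the convex set of positive semidefinite complex matrices
with unit diagonal if and only if the rank one operators `|η_i⟩⟨η_i|` span all linear
endomorphisms of `V`. -/
theorem extremal_covariant_povm_stmt13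
    (n : ℕ) (hn : 0 < n)
    {V : Type*} [NormedAddCommGroup V] [InnerProductSpace ℂ V] [FiniteDimensional ℂ V]
    (η : Fin n → V) (hspan : Submodule.span ℂ (Set.range η) = ⊤)
    (A : Matrix (Fin n) (Fin n) ℂ) (hA : ∀ i j, A i j = ⟪η i, η j⟫)
    (hdiag : ∀ i, A i i = 1) :
    (A.PosSemidef ∧ (∀ i, A i i = 1) ∧
      ∀ A₁ A₂ : Matrix (Fin n) (Fin n) ℂ,
        A₁.PosSemidef → (∀ i, A₁ i i = 1) → A₂.PosSemidef → (∀ i, A₂ i i = 1) →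
        ∀ t : ℝ, 0 < t → t < 1 →
          A = (t : ℂ) • A₁ + ((1 - t : ℝ) : ℂ) • A₂ → A₁ = A ∧ A₂ = A) ↔
    Submodule.span ℂ
        (Set.range fun i : Fin n => (innerSL ℂ (η i)).smulRight (η i)) = ⊤ := by
  have hAg : A = Matrix.of fun i j => ⟪η i, (1 : V →L[ℂ] V) (η j)⟫ := by
    ext i j; simp [hA]
  have hAp : A.PosSemidef := by
    rw [hAg]; exact gram_psd η _ ContinuousLinearMap.isPositive_one
  constructor
  · rintro ⟨-, -, hext⟩
    exact span_of_ext η (all_zero η (sa_zero η hspan A hA hdiag hext))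
  · intro hs
    refine ⟨hAp, hdiag, ?_⟩
    intro A₁ A₂ hp1 hd1 hp2 hd2 t ht0 ht1 hAe
    have hz : A₁ - A = 0 := by
      refine ext_of_span η hspan hs _ (hp1.isHermitian.sub hAp.isHermitian)
        (fun i => by simp [hd1, hdiag]) ?_
      intro x hx
      have hAx : dotProduct (star x) (A.mulVec x) = 0 := by
        rw [hAg, gram_aux, hx]; simp
      have h1 := hp1.dotProduct_mulVec_nonneg x
      have h2 := hp2.dotProduct_mulVec_nonneg x
      have hsum := hAx
      rw [hAe, Matrix.add_mulVec, Matrix.smul_mulVec, Matrix.smul_mulVec, dotProduct_add,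
        dotProduct_smul, dotProduct_smul, smul_eq_mul, smul_eq_mul] at hsum
      have ht : (0 : ℂ) < (t : ℂ) := by exact_mod_cast ht0
      have ht' : (0 : ℂ) ≤ ((1 - t : ℝ) : ℂ) := by exact_mod_cast (sub_nonneg.2 ht1.le)
      have h3 := ((add_eq_zero_iff_of_nonneg (mul_nonneg ht.le h1) (mul_nonneg ht' h2)).1 hsum).1
      have h4 := (mul_eq_zero.1 h3).resolve_left ht.ne'
      rw [Matrix.sub_mulVec, (hp1.dotProduct_mulVec_zero_iff x).1 h4,
        (hAp.dotProduct_mulVec_zero_iff x).1 hAx, sub_zero]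
    have hA1 : A₁ = A := sub_eq_zero.1 hz
    refine ⟨hA1, ?_⟩
    have hne : ((1 - t : ℝ) : ℂ) ≠ 0 := by exact_mod_cast (sub_pos.2 ht1).ne'
    rw [hA1] at hAe
    have : ((1 - t : ℝ) : ℂ) • (A₂ - A) = 0 := by
      rw [smul_sub]
      have h5 : ((1 - t : ℝ) : ℂ) • A₂ = A - (t : ℂ) • A := eq_sub_of_add_eq' hAe.symm
      rw [h5]
      push_cast
      rw [sub_smul, one_smul, sub_self]
    exact sub_eq_zero.1 ((smul_eq_zero.1 this).resolve_left hne)
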